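/- Let ρ(γ) > 0 be smooth and K(γ) satisfy ((1/ρ)∂ρ/∂γ − K) × γ = 0. Then the 6×6 skew-symmetric matrix field P = (1/ρ(γ)) P₀, where P₀ has block form [[M̂ − S Γ̂, Γ̂],[Γ̂, 0]] with M̂, Γ̂ the standard skew matrices of M and γ, and S = K(γ)·M, satisfies the Jacobi identity, i.e., defines a Poisson structure on ℝ⁶(M,γ). -/

import Mathlib

open Matrix

/-- The skew-symmetric 3×3 matrix `â` of a vector `a ∈ ℝ³`, with `â x = a × x`. -/
def hat (a : Fin 3 → ℝ) : Matrix (Fin 3) (Fin 3) ℝ :=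
  !![0, -a 2, a 1; a 2, 0, -a 0; -a 1, a 0, 0]

/-- Points of ℝ⁶ = ℝ³(M) × ℝ³(γ), indexed by `Fin 3 ⊕ Fin 3`
(`Sum.inl` = M-coordinates, `Sum.inr` = γ-coordinates). -/
abbrev R6 := (Fin 3 ⊕ Fin 3) → ℝ

/-- The bivector P₀ with block form [[M̂ − SΓ̂, Γ̂],[Γ̂, 0]], where S = K(γ)·M. -/
noncomputable def P0 (K : (Fin 3 → ℝ) → (Fin 3 → ℝ)) (x : R6) :
    Matrix (Fin 3 ⊕ Fin 3) (Fin 3 ⊕ Fin 3) ℝ :=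
  Matrix.fromBlocks
    (hat (x ∘ Sum.inl) - (K (x ∘ Sum.inr) ⬝ᵥ (x ∘ Sum.inl)) • hat (x ∘ Sum.inr))
    (hat (x ∘ Sum.inr)) (hat (x ∘ Sum.inr)) 0

/-- The Jacobiator of `r • A`, given the derivatives `D`. -/
noncomputable def T (r : ℝ) (A : Matrix (Fin 3 ⊕ Fin 3) (Fin 3 ⊕ Fin 3) ℝ)
    (D : (Fin 3 ⊕ Fin 3) → Matrix (Fin 3 ⊕ Fin 3) (Fin 3 ⊕ Fin 3) ℝ)
    (i j k : Fin 3 ⊕ Fin 3) : ℝ :=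
  ∑ l, ((r • A) l j * D l i k + (r • A) l i * D l k j + (r • A) l k * D l j i)

lemma hat_skew (a : Fin 3 → ℝ) : (hat a)ᵀ = -hat a := by
  ext i j; fin_cases i <;> fin_cases j <;> simp [hat]

lemma fromBlocks_hat_skew (X Y : Matrix (Fin 3) (Fin 3) ℝ) (hX : Xᵀ = -X) (hY : Yᵀ = -Y) :
    (Matrix.fromBlocks X Y Y 0)ᵀ = -Matrix.fromBlocks X Y Y 0 := by
  rw [fromBlocks_transpose, hX, hY, fromBlocks_neg]; simp

lemma skew_zero (f : Fin 3 → Fin 3 → ℝ) (hf : ∀ i j, f i j = -f j i)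
    (h1 : f 0 1 = 0) (h2 : f 0 2 = 0) (h3 : f 1 2 = 0) (i j : Fin 3) : f i j = 0 := by
  have := hf 0 0
  have := hf 1 1
  have := hf 2 2
  have := hf 1 0
  have := hf 2 0
  have := hf 2 1
  fin_cases i <;> fin_cases j <;> simp <;> linarith

set_option maxHeartbeats 8000000 in
/-- The Jacobi identity for index triples starting with an ordered pair in one block. -/
lemma jacobi_base (M γ K g d : Fin 3 → ℝ) (r : ℝ)
    (h : γ = 0 ∨ ∃ c : ℝ, g = K + c • γ)
    (A : Matrix (Fin 3 ⊕ Fin 3) (Fin 3 ⊕ Fin 3) ℝ)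
    (hA : A = Matrix.fromBlocks (hat M - (K ⬝ᵥ M) • hat γ) (hat γ) (hat γ) 0)
    (D : (Fin 3 ⊕ Fin 3) → Matrix (Fin 3 ⊕ Fin 3) (Fin 3 ⊕ Fin 3) ℝ)
    (hDl : ∀ m, D (Sum.inl m) = r • Matrix.fromBlocks
      (hat (Pi.single m 1) - (K m) • hat γ) 0 0 0)
    (hDr : ∀ m, D (Sum.inr m) = (-(r * g m)) • A + r • Matrix.fromBlocks
      (-(d m) • hat γ - (K ⬝ᵥ M) • hat (Pi.single m 1)) (hat (Pi.single m 1))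
        (hat (Pi.single m 1)) 0)
    (i j k : Fin 3 ⊕ Fin 3)
    (hij : (i, j) ∈ ([(Sum.inl 0, Sum.inl 1), (Sum.inl 0, Sum.inl 2), (Sum.inl 1, Sum.inl 2),
      (Sum.inr 0, Sum.inr 1), (Sum.inr 0, Sum.inr 2), (Sum.inr 1, Sum.inr 2)] :
      List ((Fin 3 ⊕ Fin 3) × (Fin 3 ⊕ Fin 3)))) :
    T r A D i j k = 0 := by
  unfold T
  rw [Fintype.sum_sum_type]
  simp only [Fin.sum_univ_three, hDl, hDr]
  subst hA
  generalize hS : K ⬝ᵥ M = S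
  simp only [dotProduct, Fin.sum_univ_three] at hS
  simp only [List.mem_cons, Prod.mk.injEq, List.not_mem_nil, or_false] at hij
  rcases h with h | ⟨c, rfl⟩
  · subst h
    rcases hij with ⟨rfl, rfl⟩ | ⟨rfl, rfl⟩ | ⟨rfl, rfl⟩ | ⟨rfl, rfl⟩ | ⟨rfl, rfl⟩ | ⟨rfl, rfl⟩ <;>
    rcases k with k | k <;> fin_cases k <;> simp [hat]
  · rcases hij with ⟨rfl, rfl⟩ | ⟨rfl, rfl⟩ | ⟨rfl, rfl⟩ | ⟨rfl, rfl⟩ | ⟨rfl, rfl⟩ | ⟨rfl, rfl⟩ <;>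
    rcases k with k | k <;> fin_cases k <;>
    simp [hat] <;> subst hS <;> ring

/-- Algebraic core: the Jacobi identity after all derivatives are computed. -/
lemma jacobi_alg (M γ K g d : Fin 3 → ℝ) (r : ℝ)
    (h : γ = 0 ∨ ∃ c : ℝ, g = K + c • γ)
    (A : Matrix (Fin 3 ⊕ Fin 3) (Fin 3 ⊕ Fin 3) ℝ)
    (hA : A = Matrix.fromBlocks (hat M - (K ⬝ᵥ M) • hat γ) (hat γ) (hat γ) 0)
    (D : (Fin 3 ⊕ Fin 3) → Matrix (Fin 3 ⊕ Fin 3) (Fin 3 ⊕ Fin 3) ℝ)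
    (hDl : ∀ m, D (Sum.inl m) = r • Matrix.fromBlocks
      (hat (Pi.single m 1) - (K m) • hat γ) 0 0 0)
    (hDr : ∀ m, D (Sum.inr m) = (-(r * g m)) • A + r • Matrix.fromBlocks
      (-(d m) • hat γ - (K ⬝ᵥ M) • hat (Pi.single m 1)) (hat (Pi.single m 1))
        (hat (Pi.single m 1)) 0)
    (i j k : Fin 3 ⊕ Fin 3) :
    ∑ l, ((r • A) l j * D l i k + (r • A) l i * D l k j + (r • A) l k * D l j i) = 0 := by
  have hAs : ∀ a b, A a b = -A b a := by
    intro a b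
    have := congrFun (congrFun (fromBlocks_hat_skew (hat M - (K ⬝ᵥ M) • hat γ) (hat γ)
      (by simp [hat_skew]; abel) (hat_skew γ)) b) a
    rw [hA]
    simpa using this
  have hDs : ∀ l a b, D l a b = -D l b a := by
    intro l a b
    rcases l with m | m
    · have := congrFun (congrFun (fromBlocks_hat_skew
        (hat (Pi.single m 1) - (K m) • hat γ) 0 (by simp [hat_skew]; abel) (by simp)) b) a
      simp only [transpose_apply, Matrix.neg_apply] at this
      rw [hDl, Matrix.smul_apply, Matrix.smul_apply, this, smul_neg]
    · have := congrFun (congrFun (fromBlocks_hat_skew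
        (-(d m) • hat γ - (K ⬝ᵥ M) • hat (Pi.single m 1)) (hat (Pi.single m 1))
        (by simp [hat_skew, -neg_smul, smul_neg, sub_eq_add_neg]; abel) (hat_skew _)) b) a
      simp only [transpose_apply, Matrix.neg_apply] at this
      rw [hDr, Matrix.add_apply, Matrix.add_apply, Matrix.smul_apply, Matrix.smul_apply, Matrix.smul_apply, Matrix.smul_apply, this,
        hAs a b, smul_neg, smul_neg, neg_add]
  have hcyc : ∀ i j k, T r A D i j k = T r A D j k i := by
    intro i j k
    refine Finset.sum_congr rfl fun l _ => ?_
    rw [hDs l i k, hDs l j i, hDs l k j]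
    ring
  have hsw : ∀ i j k, T r A D i j k = -T r A D j i k := by
    intro i j k
    unfold T
    rw [← Finset.sum_neg_distrib]
    refine Finset.sum_congr rfl fun l _ => ?_
    rw [hDs l i k, hDs l j i, hDs l k j]
    ring
  change T r A D i j k = 0
  have hll : ∀ (i j : Fin 3) k, T r A D (Sum.inl i) (Sum.inl j) k = 0 := by
    intro i j k
    refine skew_zero (fun i j => T r A D (Sum.inl i) (Sum.inl j) k)
      (fun i j => hsw _ _ _) ?_ ?_ ?_ i j <;>
    exact jacobi_base M γ K g d r h A hA D hDl hDr _ _ k (by simp)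
  have hrr : ∀ (i j : Fin 3) k, T r A D (Sum.inr i) (Sum.inr j) k = 0 := by
    intro i j k
    refine skew_zero (fun i j => T r A D (Sum.inr i) (Sum.inr j) k)
      (fun i j => hsw _ _ _) ?_ ?_ ?_ i j <;>
    exact jacobi_base M γ K g d r h A hA D hDl hDr _ _ k (by simp)
  rcases i with i | i <;> rcases j with j | j <;> rcases k with k | k
  · exact hll _ _ _
  · exact hll _ _ _
  · rw [hcyc, hcyc]; exact hll _ _ _
  · rw [hcyc]; exact hrr _ _ _
  · rw [hcyc]; exact hll _ _ _
  · rw [hcyc, hcyc]; exact hrr _ _ _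
  · exact hrr _ _ _
  · exact hrr _ _ _

lemma cross_cases (u γ : Fin 3 → ℝ) (h : crossProduct u γ = 0) :
    γ = 0 ∨ ∃ c : ℝ, u = c • γ := by
  by_cases h0 : γ = 0
  · exact Or.inl h0
  right
  have h1 := congrFun h 0
  have h2 := congrFun h 1
  have h3 := congrFun h 2
  simp [cross_apply] at h1 h2 h3
  have : γ 0 ≠ 0 ∨ γ 1 ≠ 0 ∨ γ 2 ≠ 0 := by
    by_contra! hc
    apply h0
    ext i
    fin_cases i <;> simp [hc]
  rcases this with hh | hh | hh
  · refine ⟨u 0 / γ 0, ?_⟩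
    ext i
    fin_cases i <;> simp <;> field_simp <;> linarith
  · refine ⟨u 1 / γ 1, ?_⟩
    ext i
    fin_cases i <;> simp <;> field_simp <;> linarith
  · refine ⟨u 2 / γ 2, ?_⟩
    ext i
    fin_cases i <;> simp <;> field_simp <;> linarith

/-- `y ↦ hat (y ∘ s) a b` is linear. -/
lemma hasFDerivAt_hat (s : Fin 3 → Fin 3 ⊕ Fin 3) (x : R6) (a b : Fin 3) :
    ∃ L : R6 →L[ℝ] ℝ, HasFDerivAt (fun y : R6 => hat (y ∘ s) a b) L x ∧
      ∀ v, L v = hat (v ∘ s) a b := by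
  have hl : IsLinearMap ℝ (fun y : R6 => hat (y ∘ s) a b) := by
    constructor
    · intro y z
      fin_cases a <;> fin_cases b <;> simp [hat] <;> ring
    · intro c y
      fin_cases a <;> fin_cases b <;> simp [hat]
  exact ⟨(hl.mk' _).toContinuousLinearMap, (hl.mk' _).toContinuousLinearMap.hasFDerivAt,
    fun v => rfl⟩

lemma fderiv_entry (K : (Fin 3 → ℝ) → (Fin 3 → ℝ)) (hK : Differentiable ℝ K)
    (r : R6 → ℝ) (x : R6) (hr : DifferentiableAt ℝ r x) (v : R6) (i k : Fin 3 ⊕ Fin 3) :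
    fderiv ℝ (fun y => r y * P0 K y i k) x v =
      (fderiv ℝ r x v • P0 K x + r x • Matrix.fromBlocks
        (hat (v ∘ Sum.inl)
          - (K (x ∘ Sum.inr) ⬝ᵥ (v ∘ Sum.inl)
             + fderiv ℝ K (x ∘ Sum.inr) (v ∘ Sum.inr) ⬝ᵥ (x ∘ Sum.inl)) • hat (x ∘ Sum.inr)
          - (K (x ∘ Sum.inr) ⬝ᵥ (x ∘ Sum.inl)) • hat (v ∘ Sum.inr))
        (hat (v ∘ Sum.inr)) (hat (v ∘ Sum.inr)) 0) i k := by
  have hin : ∀ s : Fin 3 → Fin 3 ⊕ Fin 3, HasFDerivAt (fun y : R6 => y ∘ s)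
      (ContinuousLinearMap.pi fun m => ContinuousLinearMap.proj (s m)) x := fun s =>
    (ContinuousLinearMap.pi fun m =>
      (ContinuousLinearMap.proj (s m) : R6 →L[ℝ] ℝ)).hasFDerivAt
  have hKc := (hK (x ∘ Sum.inr)).hasFDerivAt.comp x (hin Sum.inr)
  have hKm : ∀ m, HasFDerivAt (fun y : R6 => K (y ∘ Sum.inr) m) _ x :=
    fun m => (hasFDerivAt_pi'.1 hKc) m
  have hMm : ∀ m, HasFDerivAt (fun y : R6 => y (Sum.inl m)) _ x :=
    fun m => (ContinuousLinearMap.proj (Sum.inl m) : R6 →L[ℝ] ℝ).hasFDerivAt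
  have hS : HasFDerivAt (fun y : R6 => K (y ∘ Sum.inr) ⬝ᵥ (y ∘ Sum.inl)) _ x :=
    HasFDerivAt.fun_sum (u := Finset.univ) fun m _ => (hKm m).mul (hMm m)
  rcases i with i | i <;> rcases k with k | k
  · obtain ⟨L1, h1, e1⟩ := hasFDerivAt_hat Sum.inl x i k
    obtain ⟨L2, h2, e2⟩ := hasFDerivAt_hat Sum.inr x i k
    have := hr.hasFDerivAt.mul (h1.sub (hS.mul h2))
    refine (congrArg (fun L => L v) this.fderiv).trans ?_
    have hv : ((ContinuousLinearMap.pi fun m =>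
      (ContinuousLinearMap.proj (Sum.inr m : Fin 3 ⊕ Fin 3) : R6 →L[ℝ] ℝ)) v) = v ∘ Sum.inr := rfl
    simp [P0, e1, e2, hv, dotProduct, Fin.sum_univ_three]
    ring
  · obtain ⟨L2, h2, e2⟩ := hasFDerivAt_hat Sum.inr x i k
    have := hr.hasFDerivAt.mul h2
    refine (congrArg (fun L => L v) this.fderiv).trans ?_
    simp [P0, e2]
    ring
  · obtain ⟨L2, h2, e2⟩ := hasFDerivAt_hat Sum.inr x i k
    have := hr.hasFDerivAt.mul h2
    refine (congrArg (fun L => L v) this.fderiv).trans ?_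
    simp [P0, e2]
    ring
  · simp [P0]

/-- if ρ(γ) > 0 is smooth and K(γ) satisfies
((1/ρ)∂ρ/∂γ − K) × γ = 0, then P = ρ⁻¹ P₀ satisfies the Jacobi identity, i.e.,
defines a Poisson structure on ℝ⁶(M,γ). -/
theorem statement7
    (ρ : (Fin 3 → ℝ) → ℝ) (hρ : ContDiff ℝ (⊤ : ℕ∞) ρ) (hρpos : ∀ γ, 0 < ρ γ)
    (K : (Fin 3 → ℝ) → (Fin 3 → ℝ)) (hK : ContDiff ℝ (⊤ : ℕ∞) K)
    (hmeas : ∀ γ : Fin 3 → ℝ,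
      crossProduct ((fun i => (ρ γ)⁻¹ * fderiv ℝ ρ γ (Pi.single i 1)) - K γ) γ = 0)
    -- the bivector P = ρ(γ)⁻¹ P₀
    (P : R6 → Matrix (Fin 3 ⊕ Fin 3) (Fin 3 ⊕ Fin 3) ℝ)
    (hP : ∀ x, P x = (ρ (x ∘ Sum.inr))⁻¹ • P0 K x) :
    -- the Jacobi identity for the bivector P
    ∀ (x : R6) (i j k : Fin 3 ⊕ Fin 3),
      ∑ l : Fin 3 ⊕ Fin 3,
        (P x l j * fderiv ℝ (fun y => P y i k) x (Pi.single l 1)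
          + P x l i * fderiv ℝ (fun y => P y k j) x (Pi.single l 1)
          + P x l k * fderiv ℝ (fun y => P y j i) x (Pi.single l 1)) = 0 := by
  intro x i j k
  have hρd : Differentiable ℝ ρ := hρ.differentiable (by simp)
  have hKd : Differentiable ℝ K := hK.differentiable (by simp)
  have hPe : ∀ i k, (fun y => P y i k) = fun y => (ρ (y ∘ Sum.inr))⁻¹ * P0 K y i k := by
    intro i k; funext y; simp [hP]
  have hin : HasFDerivAt (fun y : R6 => y ∘ Sum.inr)
      (ContinuousLinearMap.pi fun m =>
        (ContinuousLinearMap.proj (Sum.inr m : Fin 3 ⊕ Fin 3) : R6 →L[ℝ] ℝ)) x :=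
    (ContinuousLinearMap.pi fun m =>
      (ContinuousLinearMap.proj (Sum.inr m : Fin 3 ⊕ Fin 3) : R6 →L[ℝ] ℝ)).hasFDerivAt
  have hρc : HasFDerivAt (fun y : R6 => ρ (y ∘ Sum.inr)) _ x :=
    (hρd (x ∘ Sum.inr)).hasFDerivAt.comp x hin
  have hne : ρ (x ∘ Sum.inr) ≠ 0 := (hρpos _).ne'
  have hr := (hasDerivAt_inv hne).comp_hasFDerivAt x hρc
  have hr' : ∀ v : R6, fderiv ℝ (fun y : R6 => (ρ (y ∘ Sum.inr))⁻¹) x v =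
      -((ρ (x ∘ Sum.inr))⁻¹ * ((ρ (x ∘ Sum.inr))⁻¹ *
        fderiv ℝ ρ (x ∘ Sum.inr) (v ∘ Sum.inr))) := by
    intro v
    refine (congrArg (fun L => L v) hr.fderiv).trans ?_
    have hv : ((ContinuousLinearMap.pi fun m =>
      (ContinuousLinearMap.proj (Sum.inr m : Fin 3 ⊕ Fin 3) : R6 →L[ℝ] ℝ)) v) = v ∘ Sum.inr := rfl
    simp [hv]
    field_simp
  have hll : ∀ m : Fin 3, (Pi.single (Sum.inl m) 1 : R6) ∘ Sum.inl = Pi.single m 1 := by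
    intro m; ext n; simp [Pi.single_apply]
  have hlr : ∀ m : Fin 3, (Pi.single (Sum.inl m) 1 : R6) ∘ Sum.inr = 0 := by
    intro m; ext n; simp
  have hrl : ∀ m : Fin 3, (Pi.single (Sum.inr m) 1 : R6) ∘ Sum.inl = 0 := by
    intro m; ext n; simp
  have hrr : ∀ m : Fin 3, (Pi.single (Sum.inr m) 1 : R6) ∘ Sum.inr = Pi.single m 1 := by
    intro m; ext n; simp [Pi.single_apply]
  have hat0 : hat 0 = 0 := by
    ext a b; fin_cases a <;> fin_cases b <;> simp [hat]
  have hfd := fun v => fderiv_entry K hKd (fun y : R6 => (ρ (y ∘ Sum.inr))⁻¹) x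
    hr.differentiableAt v
  simp only [hPe]
  simp only [hfd, hr', hP]
  refine jacobi_alg (x ∘ Sum.inl) (x ∘ Sum.inr) (K (x ∘ Sum.inr))
    (fun m => (ρ (x ∘ Sum.inr))⁻¹ * fderiv ℝ ρ (x ∘ Sum.inr) (Pi.single m 1))
    (fun m => fderiv ℝ K (x ∘ Sum.inr) (Pi.single m 1) ⬝ᵥ (x ∘ Sum.inl))
    ((ρ (x ∘ Sum.inr))⁻¹) ?_ (P0 K x) rfl
    (fun l => _) ?_ ?_ i j k
  · rcases cross_cases _ _ (hmeas (x ∘ Sum.inr)) with h | ⟨c, h⟩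
    · exact Or.inl h
    · exact Or.inr ⟨c, by rw [← h]; abel⟩
  · intro m
    simp [hll, hlr, hat0]
  · intro m
    simp [hrl, hrr, hat0]
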